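/- arXiv:2512.01655 — 2 statements merged into one kernel-verified Lean document; each statement's English description precedes it below -/
import Mathlib

section
/- There exists a constant C > 0 such that for all u, v ∈ L^{8/3}(ℝ²), ∬_{ℝ²×ℝ²} log(1 + 1/|x−y|) u(x)² v(y)² dx dy ≤ C ‖u‖_{8/3}² ‖v‖_{8/3}², where the integrand is interpreted as 0 on the (Lebesgue-null) diagonal {x = y} and the double integral is taken in [0,∞]. -/
open MeasureTheory

noncomputable section

abbrev Plane := EuclideanSpace ℝ (Fin 2)

/-- Integration of a nonnegative radial function on the plane in polar coordinates. -/
theorem lintegral_ofReal_fun_norm_plane {f : ℝ → ℝ} (hf : ∀ r, 0 ≤ f r)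
    (hi : IntegrableOn (fun r ↦ r * f r) (Set.Ioi 0)) :
    ∫⁻ z : Plane, ENNReal.ofReal (f ‖z‖) =
      ENNReal.ofReal (2 * volume.real (Metric.ball (0 : Plane) 1) *
        ∫ r in Set.Ioi (0 : ℝ), r * f r) := by
  have h1 : Integrable (fun z : Plane ↦ f ‖z‖) := by
    rw [integrable_fun_norm_addHaar]
    simpa using hi
  rw [← ofReal_integral_eq_lintegral_ofReal h1 (Filter.Eventually.of_forall fun z ↦ hf _),
    integral_fun_norm_addHaar]
  simp [mul_assoc]

theorem lintegral_ofReal_inv_norm_near {R : ℝ} (hR : 0 < R) :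
    ∫⁻ z : Plane, ENNReal.ofReal ((Set.Iio R).indicator (fun r ↦ |r|⁻¹) ‖z‖) =
      ENNReal.ofReal (2 * volume.real (Metric.ball (0 : Plane) 1) * R) := by
  have key : Set.EqOn (fun r ↦ r * (Set.Iio R).indicator (fun r ↦ |r|⁻¹) r)
      ((Set.Iio R).indicator fun _ ↦ 1) (Set.Ioi 0) := by
    intro r hr
    have hr' : 0 < r := hr
    by_cases h : r < R <;> simp [h, abs_of_pos hr', hr'.ne']
  rw [lintegral_ofReal_fun_norm_plane (fun r ↦ Set.indicator_nonneg (fun _ _ ↦ by positivity) r),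
    setIntegral_congr_fun measurableSet_Ioi key, setIntegral_indicator measurableSet_Iio,
    Set.Ioi_inter_Iio]
  · simp [hR.le]
  · rw [integrableOn_congr_fun key measurableSet_Ioi, IntegrableOn,
      integrable_indicator_iff measurableSet_Iio, IntegrableOn,
      Measure.restrict_restrict measurableSet_Iio, Set.Iio_inter_Ioi]
    simp

theorem lintegral_ofReal_inv_norm_far {R : ℝ} (hR : 0 < R) :
    ∫⁻ z : Plane, ENNReal.ofReal ((Set.Ioi R).indicator (fun r ↦ |r|⁻¹) ‖z‖) ^ (4 : ℝ) =
      ENNReal.ofReal (volume.real (Metric.ball (0 : Plane) 1) * R ^ (-2 : ℝ)) := by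
  have h0 : ∀ z : Plane, ENNReal.ofReal ((Set.Ioi R).indicator (fun r ↦ |r|⁻¹) ‖z‖) ^ (4 : ℝ) =
      ENNReal.ofReal ((Set.Ioi R).indicator (fun r ↦ |r| ^ (-4 : ℝ)) ‖z‖) := by
    intro z
    rw [ENNReal.ofReal_rpow_of_nonneg (Set.indicator_nonneg (fun _ _ ↦ by positivity) _)
      (by norm_num)]
    by_cases h : R < ‖z‖
    · simp [h]
    · simp [h]
  have key : Set.EqOn (fun r ↦ r * (Set.Ioi R).indicator (fun r ↦ |r| ^ (-4 : ℝ)) r)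
      ((Set.Ioi R).indicator fun r ↦ r ^ (-3 : ℝ)) (Set.Ioi 0) := by
    intro r hr
    have hr' : 0 < r := hr
    by_cases h : R < r
    · simp only [Set.mem_Ioi, h, Set.indicator_of_mem, abs_of_pos hr']
      rw [← Real.rpow_one_add' hr'.le (by norm_num)]
      norm_num
    · simp [h]
  have hsub : Set.Ioi (0 : ℝ) ∩ Set.Ioi R = Set.Ioi R :=
    Set.inter_eq_right.2 (Set.Ioi_subset_Ioi hR.le)
  simp_rw [h0]
  rw [lintegral_ofReal_fun_norm_plane (fun r ↦ Set.indicator_nonneg (fun _ _ ↦ by positivity) r),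
    setIntegral_congr_fun measurableSet_Ioi key, setIntegral_indicator measurableSet_Ioi,
    hsub, integral_Ioi_rpow_of_lt (by norm_num) hR]
  · congr 1
    norm_num
    ring
  · rw [integrableOn_congr_fun key measurableSet_Ioi, IntegrableOn,
      integrable_indicator_iff measurableSet_Ioi, IntegrableOn,
      Measure.restrict_restrict measurableSet_Ioi, Set.inter_comm, hsub]
    exact integrableOn_Ioi_rpow_of_lt (by norm_num) hR

/-- The constant in the bound for the Riesz potential of a bounded function. -/
def rieszConst : ℝ :=
  2 * volume.real (Metric.ball (0 : Plane) 1) +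
    volume.real (Metric.ball (0 : Plane) 1) ^ (1 / 4 : ℝ)

theorem rieszConst_pos : 0 < rieszConst := by
  have : 0 < volume.real (Metric.ball (0 : Plane) 1) :=
    ENNReal.toReal_pos (Metric.measure_ball_pos _ _ one_pos).ne' measure_ball_lt_top.ne
  unfold rieszConst
  positivity

/-- The Riesz potential of a function bounded by `t` in the unit ball of `L^{4/3}` is `O(t^{1/3})`. -/
theorem lintegral_inv_dist_mul_le (x : Plane) {t : ℝ} (ht : 0 < t) {h : Plane → ENNReal}
    (hm : Measurable h) (hle : ∀ y, h y ≤ ENNReal.ofReal t)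
    (hInt : ∫⁻ y, h y ^ (4 / 3 : ℝ) ≤ 1) :
    ∫⁻ y, ENNReal.ofReal ‖x - y‖⁻¹ * h y ≤ ENNReal.ofReal (rieszConst * t ^ (1 / 3 : ℝ)) := by
  set c := volume.real (Metric.ball (0 : Plane) 1) with hc
  have hc0 : 0 ≤ c := measureReal_nonneg
  set R := t ^ (-2 / 3 : ℝ) with hRdef
  have hR : 0 < R := by positivity
  let a : Plane → ENNReal := fun z ↦
    ENNReal.ofReal ((Set.Iio R).indicator (fun r ↦ |r|⁻¹) ‖z‖)
  let b : Plane → ENNReal := fun z ↦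
    ENNReal.ofReal ((Set.Ioi R).indicator (fun r ↦ |r|⁻¹) ‖z‖)
  have ha : Measurable a := by
    have hi : Measurable ((Set.Iio R).indicator fun r : ℝ ↦ |r|⁻¹) :=
      Measurable.indicator (by fun_prop) measurableSet_Iio
    exact ENNReal.measurable_ofReal.comp (hi.comp measurable_norm)
  have hb : Measurable b := by
    have hi : Measurable ((Set.Ioi R).indicator fun r : ℝ ↦ |r|⁻¹) :=
      Measurable.indicator (by fun_prop) measurableSet_Ioi
    exact ENNReal.measurable_ofReal.comp (hi.comp measurable_norm)
  have hsphere : ∀ᵐ y : Plane, ‖x - y‖ ≠ R := by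
    have := Measure.addHaar_sphere_of_ne_zero (volume : Measure Plane) x hR.ne'
    filter_upwards [measure_eq_zero_iff_ae_notMem.1 this] with y hy h
    exact hy (by rw [mem_sphere_iff_norm, norm_sub_rev, h])
  have hpt : ∀ᵐ y : Plane, ENNReal.ofReal ‖x - y‖⁻¹ * h y ≤
      a (x - y) * ENNReal.ofReal t + b (x - y) * h y := by
    filter_upwards [hsphere] with y hy
    rcases lt_or_gt_of_ne hy with h1 | h1
    · have : a (x - y) = ENNReal.ofReal ‖x - y‖⁻¹ := by simp [a, h1]
      rw [this]
      exact le_add_right (mul_le_mul_right (hle y) _)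
    · have : b (x - y) = ENNReal.ofReal ‖x - y‖⁻¹ := by simp [b, h1]
      rw [this]
      exact le_add_self
  have hA : ∫⁻ y, a (x - y) * ENNReal.ofReal t = ENNReal.ofReal (2 * c * t ^ (1 / 3 : ℝ)) := by
    rw [lintegral_mul_const _ (by fun_prop), lintegral_sub_left_eq_self,
      lintegral_ofReal_inv_norm_near hR, ← ENNReal.ofReal_mul (by positivity), mul_assoc]
    congr 2
    rw [hRdef, ← Real.rpow_add_one ht.ne']
    norm_num
  have hB : ∫⁻ y, b (x - y) * h y ≤ ENNReal.ofReal (c ^ (1 / 4 : ℝ) * t ^ (1 / 3 : ℝ)) := by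
    have hpq : Real.HolderConjugate 4 (4 / 3) := by
      rw [Real.holderConjugate_iff]; norm_num
    have hb4 : ∫⁻ y, b (x - y) ^ (4 : ℝ) = ENNReal.ofReal (c * R ^ (-2 : ℝ)) := by
      rw [lintegral_sub_left_eq_self (fun z ↦ b z ^ (4 : ℝ)), lintegral_ofReal_inv_norm_far hR]
    have hh := ENNReal.lintegral_mul_le_Lp_mul_Lq volume hpq (f := fun y ↦ b (x - y)) (g := h)
      (by fun_prop) hm.aemeasurable
    refine hh.trans ?_
    rw [hb4]
    calc _ ≤ ENNReal.ofReal (c * R ^ (-2 : ℝ)) ^ (1 / 4 : ℝ) * 1 := by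
          gcongr
          exact ENNReal.rpow_le_one hInt (by norm_num)
      _ = _ := by
          rw [mul_one, ENNReal.ofReal_rpow_of_nonneg (by positivity) (by norm_num),
            Real.mul_rpow hc0 (by positivity), hRdef, ← Real.rpow_mul ht.le, ← Real.rpow_mul ht.le]
          norm_num
  calc _ ≤ ∫⁻ y, (a (x - y) * ENNReal.ofReal t + b (x - y) * h y) := lintegral_mono_ae hpt
    _ = _ := lintegral_add_left (by fun_prop) _
    _ ≤ _ := add_le_add hA.le hB
    _ = _ := by
        rw [← ENNReal.ofReal_add (by positivity) (by positivity), rieszConst, add_mul]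

theorem lintegral_inv_dist_mul_indicator_le {f g : Plane → ℝ} (hg : Measurable g)
    (f0 : ∀ x, 0 ≤ f x) (g0 : ∀ x, 0 ≤ g x)
    (hf1 : ∫⁻ x, ENNReal.ofReal (f x ^ (4 / 3 : ℝ)) ≤ 1)
    (hg1 : ∫⁻ x, ENNReal.ofReal (g x ^ (4 / 3 : ℝ)) ≤ 1) :
    ∫⁻ x, ∫⁻ y, ENNReal.ofReal ‖x - y‖⁻¹ *
      ({y | g y ≤ f x}.indicator (fun y ↦ ENNReal.ofReal (g y)) y * ENNReal.ofReal (f x)) ≤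
      ENNReal.ofReal rieszConst := by
  have hx : ∀ x, ∫⁻ y, ENNReal.ofReal ‖x - y‖⁻¹ *
      ({y | g y ≤ f x}.indicator (fun y ↦ ENNReal.ofReal (g y)) y * ENNReal.ofReal (f x)) ≤
      ENNReal.ofReal rieszConst * ENNReal.ofReal (f x ^ (4 / 3 : ℝ)) := by
    intro x
    rcases (f0 x).eq_or_lt with h0 | h0
    · simp [← h0]
    simp_rw [← mul_assoc]
    have hms : MeasurableSet {y | g y ≤ f x} := measurableSet_le hg measurable_const
    rw [lintegral_mul_const' _ _ ENNReal.ofReal_ne_top]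
    have := lintegral_inv_dist_mul_le x h0
      (h := {y | g y ≤ f x}.indicator (fun y ↦ ENNReal.ofReal (g y)))
      ((ENNReal.measurable_ofReal.comp hg).indicator hms)
      (fun y ↦ by
        by_cases h : g y ≤ f x
        · simpa [h] using ENNReal.ofReal_le_ofReal h
        · simp [h])
      (by
        refine le_trans (lintegral_mono fun y ↦ ?_) hg1
        rw [← ENNReal.ofReal_rpow_of_nonneg (g0 y) (by norm_num)]
        gcongr
        exact Set.indicator_le_self _ _ _)
    refine (mul_le_mul_left this _).trans_eq ?_
    have hr := rieszConst_pos
    rw [← ENNReal.ofReal_mul (by positivity), ← ENNReal.ofReal_mul hr.le, mul_assoc,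
      ← Real.rpow_add_one h0.ne']
    norm_num
  calc _ ≤ ∫⁻ x, ENNReal.ofReal rieszConst * ENNReal.ofReal (f x ^ (4 / 3 : ℝ)) :=
        lintegral_mono hx
    _ = ENNReal.ofReal rieszConst * ∫⁻ x, ENNReal.ofReal (f x ^ (4 / 3 : ℝ)) :=
        lintegral_const_mul' _ _ ENNReal.ofReal_ne_top
    _ ≤ _ := mul_le_of_le_one_right' hf1

/-- Hardy–Littlewood–Sobolev inequality on the plane for the kernel `1/|x-y|`, normalized form. -/
theorem lintegral_inv_dist_mul_le_of_le_one {f g : Plane → ℝ} (hf : Measurable f)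
    (hg : Measurable g) (f0 : ∀ x, 0 ≤ f x) (g0 : ∀ x, 0 ≤ g x)
    (hf1 : ∫⁻ x, ENNReal.ofReal (f x ^ (4 / 3 : ℝ)) ≤ 1)
    (hg1 : ∫⁻ x, ENNReal.ofReal (g x ^ (4 / 3 : ℝ)) ≤ 1) :
    ∫⁻ x, ∫⁻ y, ENNReal.ofReal (‖x - y‖⁻¹ * f x * g y) ≤
      ENNReal.ofReal (2 * rieszConst) := by
  let I : (Plane → ℝ) → (Plane → ℝ) → Plane → Plane → ENNReal := fun f g x y ↦
    ENNReal.ofReal ‖x - y‖⁻¹ *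
      ({y | g y ≤ f x}.indicator (fun y ↦ ENNReal.ofReal (g y)) y * ENNReal.ofReal (f x))
  have hI : ∀ {f g : Plane → ℝ}, Measurable f → Measurable g →
      Measurable (Function.uncurry (I f g)) := by
    intro f g hf hg
    have : Function.uncurry (I f g) = fun p : Plane × Plane ↦ ENNReal.ofReal ‖p.1 - p.2‖⁻¹ *
        ({p : Plane × Plane | g p.2 ≤ f p.1}.indicator (fun p ↦ ENNReal.ofReal (g p.2)) p *
          ENNReal.ofReal (f p.1)) := rfl
    rw [this]
    have hi : Measurable ({p : Plane × Plane | g p.2 ≤ f p.1}.indicator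
        (fun p ↦ ENNReal.ofReal (g p.2))) :=
      Measurable.indicator (by fun_prop) (measurableSet_le (by fun_prop) (by fun_prop))
    fun_prop
  have hpt : ∀ x y, ENNReal.ofReal (‖x - y‖⁻¹ * f x * g y) ≤ I f g x y + I g f y x := by
    intro x y
    have hmul : ENNReal.ofReal (‖x - y‖⁻¹ * f x * g y) =
        ENNReal.ofReal ‖x - y‖⁻¹ * (ENNReal.ofReal (g y) * ENNReal.ofReal (f x)) := by
      rw [← ENNReal.ofReal_mul (g0 y), ← ENNReal.ofReal_mul (by positivity)]
      congr 1
      ring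
    rw [hmul]
    rcases le_total (g y) (f x) with h | h
    · refine le_add_right (le_of_eq ?_)
      simp [I, h]
    · refine le_add_left (le_of_eq ?_)
      simp [I, h, norm_sub_rev x y, mul_comm (ENNReal.ofReal (g y))]
  calc _ ≤ ∫⁻ x, ∫⁻ y, (I f g x y + I g f y x) :=
        lintegral_mono fun x ↦ lintegral_mono fun y ↦ hpt x y
    _ = ∫⁻ x, ((∫⁻ y, I f g x y) + ∫⁻ y, I g f y x) := by
        congr 1
        ext x
        exact lintegral_add_left ((hI hf hg).comp measurable_prodMk_left) _
    _ = (∫⁻ x, ∫⁻ y, I f g x y) + ∫⁻ x, ∫⁻ y, I g f y x :=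
        lintegral_add_left (hI hf hg).lintegral_prod_right _
    _ = (∫⁻ x, ∫⁻ y, I f g x y) + ∫⁻ y, ∫⁻ x, I g f y x := by
        rw [lintegral_lintegral_swap (f := fun x y ↦ I g f y x)
          ((hI hg hf).comp measurable_swap).aemeasurable]
    _ ≤ ENNReal.ofReal rieszConst + ENNReal.ofReal rieszConst :=
        add_le_add (lintegral_inv_dist_mul_indicator_le hg f0 g0 hf1 hg1)
          (lintegral_inv_dist_mul_indicator_le hf g0 f0 hg1 hf1)
    _ = _ := by
        rw [← ENNReal.ofReal_add rieszConst_pos.le rieszConst_pos.le, two_mul]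

/-- Hardy–Littlewood–Sobolev inequality on the plane for the kernel `1/|x-y|`. -/
theorem lintegral_inv_dist_mul_le_rpow {f g : Plane → ℝ} (hf : Measurable f)
    (hg : Measurable g) (f0 : ∀ x, 0 ≤ f x) (g0 : ∀ x, 0 ≤ g x) {a b : ℝ} (ha : 0 < a)
    (hb : 0 < b) (hfa : ∫⁻ x, ENNReal.ofReal (f x ^ (4 / 3 : ℝ)) ≤ ENNReal.ofReal a)
    (hgb : ∫⁻ x, ENNReal.ofReal (g x ^ (4 / 3 : ℝ)) ≤ ENNReal.ofReal b) :
    ∫⁻ x, ∫⁻ y, ENNReal.ofReal (‖x - y‖⁻¹ * f x * g y) ≤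
      ENNReal.ofReal (2 * rieszConst * a ^ (3 / 4 : ℝ) * b ^ (3 / 4 : ℝ)) := by
  have hnorm : ∀ {f : Plane → ℝ} {a : ℝ}, (∀ x, 0 ≤ f x) → 0 < a →
      ∫⁻ x, ENNReal.ofReal (f x ^ (4 / 3 : ℝ)) ≤ ENNReal.ofReal a →
      ∫⁻ x, ENNReal.ofReal ((f x / a ^ (3 / 4 : ℝ)) ^ (4 / 3 : ℝ)) ≤ 1 := by
    intro f a f0 ha h
    have : ∀ x, ENNReal.ofReal ((f x / a ^ (3 / 4 : ℝ)) ^ (4 / 3 : ℝ)) =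
        ENNReal.ofReal (f x ^ (4 / 3 : ℝ)) * ENNReal.ofReal a⁻¹ := by
      intro x
      rw [Real.div_rpow (f0 x) (by positivity), ← Real.rpow_mul ha.le,
        ← ENNReal.ofReal_mul (Real.rpow_nonneg (f0 x) _)]
      norm_num [div_eq_mul_inv]
    simp_rw [this]
    rw [lintegral_mul_const' _ _ ENNReal.ofReal_ne_top]
    refine (mul_le_mul_left h _).trans_eq ?_
    rw [← ENNReal.ofReal_mul ha.le, mul_inv_cancel₀ ha.ne', ENNReal.ofReal_one]
  have main := lintegral_inv_dist_mul_le_of_le_one (hf.div_const (a ^ (3 / 4 : ℝ)))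
    (hg.div_const (b ^ (3 / 4 : ℝ))) (fun x ↦ div_nonneg (f0 x) (by positivity))
    (fun x ↦ div_nonneg (g0 x) (by positivity)) (hnorm f0 ha hfa) (hnorm g0 hb hgb)
  have hsc : ∀ x y, ENNReal.ofReal (‖x - y‖⁻¹ * f x * g y) =
      ENNReal.ofReal (a ^ (3 / 4 : ℝ) * b ^ (3 / 4 : ℝ)) * ENNReal.ofReal
        (‖x - y‖⁻¹ * (f x / a ^ (3 / 4 : ℝ)) * (g y / b ^ (3 / 4 : ℝ))) := by
    intro x y
    rw [← ENNReal.ofReal_mul (by positivity)]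
    congr 1
    field_simp
  simp_rw [hsc]
  simp_rw [lintegral_const_mul' _ _ ENNReal.ofReal_ne_top]
  refine (mul_le_mul_right main _).trans_eq ?_
  rw [← ENNReal.ofReal_mul (by positivity)]
  congr 1
  ring

/-- HLS-type bound: `∬ log(1+1/|x−y|) u(x)² v(y)² ≲ ‖u‖_{8/3}² ‖v‖_{8/3}²`.
Note that in Lean `1/‖x-x‖ = 0` so `log (1 + 1/‖x-y‖)` vanishes on the diagonal. -/
theorem stmt8 :
    ∃ C : ℝ, 0 < C ∧ ∀ u v : Plane → ℝ, Measurable u → Measurable v →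
      (∫⁻ x, ENNReal.ofReal (|u x| ^ ((8 : ℝ) / 3)) < ⊤) →
      (∫⁻ x, ENNReal.ofReal (|v x| ^ ((8 : ℝ) / 3)) < ⊤) →
      (∫⁻ x, ∫⁻ y, ENNReal.ofReal (Real.log (1 + 1 / ‖x - y‖) * (u x) ^ 2 * (v y) ^ 2)) ≤
        ENNReal.ofReal (C *
          ((∫ x, |u x| ^ ((8 : ℝ) / 3)) ^ ((3 : ℝ) / 8)) ^ 2 *
          ((∫ x, |v x| ^ ((8 : ℝ) / 3)) ^ ((3 : ℝ) / 8)) ^ 2) := by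
  have hr := rieszConst_pos
  refine ⟨2 * rieszConst, by positivity, fun u v hu hv hui hvi ↦ ?_⟩
  have hpow : ∀ s : ℝ, (s ^ 2) ^ (4 / 3 : ℝ) = |s| ^ (8 / 3 : ℝ) := by
    intro s
    rw [← sq_abs, ← Real.rpow_natCast, ← Real.rpow_mul (abs_nonneg s)]
    norm_num
  have hInt : ∀ {w : Plane → ℝ}, Measurable w →
      ∫⁻ x, ENNReal.ofReal (|w x| ^ (8 / 3 : ℝ)) < ⊤ →
      ∫⁻ x, ENNReal.ofReal (|w x| ^ (8 / 3 : ℝ)) =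
        ENNReal.ofReal (∫ x, |w x| ^ (8 / 3 : ℝ)) := by
    intro w hw h
    have h0 : 0 ≤ᵐ[volume] fun x ↦ |w x| ^ (8 / 3 : ℝ) :=
      Filter.Eventually.of_forall fun x ↦ by positivity
    rw [ofReal_integral_eq_lintegral_ofReal _ h0]
    exact ⟨(hw.abs.pow_const _).aestronglyMeasurable, by rwa [hasFiniteIntegral_iff_ofReal h0]⟩
  have hzero : ∀ {w : Plane → ℝ}, Measurable w →
      ∫⁻ x, ENNReal.ofReal (|w x| ^ (8 / 3 : ℝ)) = 0 → ∀ᵐ x, w x = 0 := by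
    intro w hw h
    rw [lintegral_eq_zero_iff (by fun_prop)] at h
    filter_upwards [h] with x hx
    by_contra hne
    have : 0 < |w x| := abs_pos.2 hne
    have : 0 < |w x| ^ (8 / 3 : ℝ) := by positivity
    exact (ENNReal.ofReal_pos.2 this).ne' hx
  have hua := hInt hu hui
  have hvb := hInt hv hvi
  set a := ∫ x, |u x| ^ (8 / 3 : ℝ) with ha
  set b := ∫ x, |v x| ^ (8 / 3 : ℝ) with hb
  have ha0 : 0 ≤ a := integral_nonneg fun x ↦ by positivity
  have hb0 : 0 ≤ b := integral_nonneg fun x ↦ by positivity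
  rcases ha0.eq_or_lt with haz | hapos
  · have hz := hzero hu (by rw [hua, ← haz, ENNReal.ofReal_zero])
    refine le_of_eq_of_le ?_ zero_le
    rw [lintegral_congr_ae (g := fun _ ↦ 0), lintegral_zero]
    filter_upwards [hz] with x hx
    simp [hx]
  rcases hb0.eq_or_lt with hbz | hbpos
  · have hz := hzero hv (by rw [hvb, ← hbz, ENNReal.ofReal_zero])
    refine le_of_eq_of_le ?_ zero_le
    rw [lintegral_congr (g := fun _ ↦ 0), lintegral_zero]
    intro x
    rw [lintegral_congr_ae (g := fun _ ↦ 0), lintegral_zero]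
    filter_upwards [hz] with y hy
    simp [hy]
  have main := lintegral_inv_dist_mul_le_rpow (f := fun x ↦ u x ^ 2) (g := fun x ↦ v x ^ 2)
    (by fun_prop) (by fun_prop) (fun x ↦ sq_nonneg _) (fun x ↦ sq_nonneg _) hapos hbpos
    (by simp_rw [hpow]; exact hua.le) (by simp_rw [hpow]; exact hvb.le)
  have hsq : ∀ {s : ℝ}, 0 ≤ s → (s ^ (3 / 8 : ℝ)) ^ 2 = s ^ (3 / 4 : ℝ) := by
    intro s hs
    rw [← Real.rpow_natCast, ← Real.rpow_mul hs]
    norm_num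
  rw [hsq ha0, hsq hb0]
  refine le_trans (lintegral_mono fun x ↦ lintegral_mono fun y ↦ ?_) main
  have hlog : Real.log (1 + 1 / ‖x - y‖) ≤ ‖x - y‖⁻¹ := by
    have := Real.log_le_sub_one_of_pos (x := 1 + 1 / ‖x - y‖) (by positivity)
    simpa using this
  dsimp only
  gcongr
end
end

section
/- There exists a constant C > 0 such that for all u, v ∈ L^{8/3}(ℝ²), ∬_{ℝ²×ℝ²} log(1 + 1/|x−y|) (u(x)² + v(x)²)(u(y)² + v(y)²) dx dy ≤ C ( ‖u‖_{8/3}² + ‖v‖_{8/3}² )², where the integrand is interpreted as 0 on the (Lebesgue-null) diagonal {x = y} and the double integral is taken in [0,∞]. -/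
open MeasureTheory

noncomputable section

/-- The radial profile `min r⁻¹ r⁻⁴`, for `0 < r`. -/
def kernelProfile (r : ℝ) : ℝ := if r < 1 then r⁻¹ else (r ^ 4)⁻¹

lemma kernelProfile_nonneg {r : ℝ} (hr : 0 ≤ r) : 0 ≤ kernelProfile r := by
  unfold kernelProfile
  split_ifs <;> positivity

lemma integrable_kernelProfile_norm : Integrable fun z : Plane ↦ kernelProfile ‖z‖ := by
  rw [integrable_fun_norm_addHaar, finrank_euclideanSpace_fin,
    ← Set.Ioc_union_Ioi_eq_Ioi zero_le_one, integrableOn_union,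
    integrableOn_Ioc_iff_integrableOn_Ioo]
  constructor
  · refine (integrableOn_const (C := (1 : ℝ)) (by simp)).congr_fun (fun y hy ↦ ?_) measurableSet_Ioo
    have hy0 : y ≠ 0 := hy.1.ne'
    simp [kernelProfile, hy.2, hy0]
  · refine (integrableOn_Ioi_rpow_of_lt (a := -3) (by norm_num) zero_lt_one).congr_fun
      (fun y hy ↦ ?_) measurableSet_Ioi
    have hy1 : 1 < y := hy
    have hy0 : 0 < y := zero_lt_one.trans hy1
    beta_reduce
    rw [Real.rpow_neg hy0.le]
    norm_num [kernelProfile, hy1.not_gt]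
    field_simp

lemma integrable_kernelProfile_mul_norm_sub (x : Plane) {a : ℝ} (ha : 0 < a) :
    Integrable fun y : Plane ↦ kernelProfile (a * ‖x - y‖) := by
  have h := (integrable_kernelProfile_norm.comp_smul ha.ne').comp_sub_left x
  simpa [norm_smul, abs_of_pos ha] using h

lemma integral_kernelProfile_mul_norm_sub (x : Plane) {a : ℝ} (ha : 0 < a) :
    ∫ y : Plane, kernelProfile (a * ‖x - y‖) = (a ^ 2)⁻¹ * ∫ z : Plane, kernelProfile ‖z‖ := by
  have h := Measure.integral_comp_smul_of_nonneg (volume : Measure Plane)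
    (fun z ↦ kernelProfile ‖z‖) a (hR := ha.le)
  rw [finrank_euclideanSpace_fin, smul_eq_mul,
    ← integral_sub_left_eq_self (fun z : Plane ↦ kernelProfile ‖a • z‖) volume x] at h
  simpa [norm_smul, abs_of_pos ha] using h

lemma pow_three_div_le {h s B r : ℝ} (hh : 0 ≤ h) (hhs : h ≤ s) (hs : 0 < s) (hB : 0 < B)
    (hr : 0 ≤ r) :
    h ^ 3 / r ≤ s / B * h ^ 4 + s ^ 5 / B * kernelProfile (s ^ 2 / B * r) := by
  rcases hr.eq_or_lt with rfl | hr
  · have := kernelProfile_nonneg (r := s ^ 2 / B * 0) (by simp)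
    rw [div_zero]
    positivity
  unfold kernelProfile
  split_ifs with hlt
  · calc h ^ 3 / r ≤ s ^ 3 / r := by gcongr
      _ = s ^ 5 / B * (s ^ 2 / B * r)⁻¹ := by field_simp
      _ ≤ _ := le_add_of_nonneg_left (by positivity)
  · have hfar : s ^ 5 / B * ((s ^ 2 / B * r) ^ 4)⁻¹ = B ^ 3 / (s ^ 3 * r ^ 4) := by field_simp
    rw [hfar]
    by_cases hc : 1 ≤ s / B * (h * r)
    · calc h ^ 3 / r = h ^ 3 / r * 1 := by ring
        _ ≤ h ^ 3 / r * (s / B * (h * r)) := by gcongr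
        _ = s / B * h ^ 4 := by field_simp
        _ ≤ _ := le_add_of_nonneg_right (by positivity)
    · have hle : h * r ≤ B / s := by
        rw [le_div_iff₀ hs]
        have := (not_le.mp hc).le
        rw [div_mul_eq_mul_div, div_le_one hB] at this
        linarith
      calc h ^ 3 / r = (h * r) ^ 3 / r ^ 4 := by field_simp
        _ ≤ (B / s) ^ 3 / r ^ 4 := by gcongr
        _ = B ^ 3 / (s ^ 3 * r ^ 4) := by field_simp
        _ ≤ _ := le_add_of_nonneg_left (by positivity)

lemma lintegral_sublevel_le {g : Plane → ℝ} (hg : ∀ x, 0 ≤ g x)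
    (hint : Integrable fun x ↦ g x ^ 4) {B : ℝ} (hB : 0 < B) (hB2 : B ^ 2 = ∫ x, g x ^ 4)
    (x : Plane) :
    ∫⁻ y, ENNReal.ofReal (if g y ≤ g x then g x ^ 3 * g y ^ 3 / ‖x - y‖ else 0) ≤
      ENNReal.ofReal ((1 + ∫ z : Plane, kernelProfile ‖z‖) * B * g x ^ 4) := by
  rcases (hg x).eq_or_lt with hs | hs
  · simp [← hs]
  set s := g x
  have ha : 0 < s ^ 2 / B := by positivity
  have hi1 : Integrable fun y ↦ s / B * g y ^ 4 := hint.const_mul _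
  have hi2 : Integrable fun y ↦ s ^ 5 / B * kernelProfile (s ^ 2 / B * ‖x - y‖) :=
    (integrable_kernelProfile_mul_norm_sub x ha).const_mul _
  have hi : Integrable fun y ↦
      s / B * g y ^ 4 + s ^ 5 / B * kernelProfile (s ^ 2 / B * ‖x - y‖) := hi1.add hi2
  have hk (y : Plane) : 0 ≤ kernelProfile (s ^ 2 / B * ‖x - y‖) :=
    kernelProfile_nonneg (by positivity)
  calc
    _ ≤ ∫⁻ y, ENNReal.ofReal (s ^ 3 *
          (s / B * g y ^ 4 + s ^ 5 / B * kernelProfile (s ^ 2 / B * ‖x - y‖))) := by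
      refine lintegral_mono fun y ↦ ENNReal.ofReal_le_ofReal ?_
      split_ifs with h
      · rw [mul_div_assoc]
        gcongr
        exact pow_three_div_le (hg y) h hs hB (norm_nonneg _)
      · have := hk y
        positivity
    _ = ENNReal.ofReal (∫ y, s ^ 3 *
          (s / B * g y ^ 4 + s ^ 5 / B * kernelProfile (s ^ 2 / B * ‖x - y‖))) := by
      refine (ofReal_integral_eq_lintegral_ofReal (hi.const_mul _)
        (.of_forall fun y ↦ ?_)).symm
      have := hk y
      dsimp only [Pi.zero_apply]
      positivity
    _ = _ := by
      rw [integral_const_mul, integral_add hi1 hi2, integral_const_mul, integral_const_mul,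
        integral_kernelProfile_mul_norm_sub x ha, ← hB2]
      congr 1
      field_simp

/-- The Hardy–Littlewood–Sobolev inequality on the plane with kernel `|x - y|⁻¹`, applied to the
function `g ^ 3 ∈ L^{4/3}`. -/
lemma hardyLittlewoodSobolev_plane {g : Plane → ℝ} (hgm : Measurable g) (hg : ∀ x, 0 ≤ g x)
    (hint : Integrable fun x ↦ g x ^ 4) :
    ∫⁻ x, ∫⁻ y, ENNReal.ofReal (g x ^ 3 * g y ^ 3 / ‖x - y‖) ≤
      ENNReal.ofReal (2 * (1 + ∫ z : Plane, kernelProfile ‖z‖) * √(∫ x, g x ^ 4) ^ 3) := by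
  have hI : 0 ≤ ∫ x, g x ^ 4 := integral_nonneg fun x ↦ by positivity
  have hK : 0 ≤ ∫ z : Plane, kernelProfile ‖z‖ :=
    integral_nonneg fun z ↦ kernelProfile_nonneg (norm_nonneg _)
  rcases hI.eq_or_lt with h0 | hpos
  · have hae : ∀ᵐ x, g x ^ 4 = 0 :=
      (integral_eq_zero_iff_of_nonneg (fun x ↦ by dsimp; positivity) hint).mp h0.symm
    have hzero : ∫⁻ x, ∫⁻ y, ENNReal.ofReal (g x ^ 3 * g y ^ 3 / ‖x - y‖) = 0 := by
      rw [← lintegral_zero (μ := (volume : Measure Plane))]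
      refine lintegral_congr_ae ?_
      filter_upwards [hae] with x hx
      simp [(pow_eq_zero_iff four_ne_zero).mp hx]
    simp [hzero]
  set B := √(∫ x, g x ^ 4)
  have hB : 0 < B := Real.sqrt_pos.mpr hpos
  have hB2 : B ^ 2 = ∫ x, g x ^ 4 := Real.sq_sqrt hI
  let Ψ (x y : Plane) : ENNReal :=
    ENNReal.ofReal (if g y ≤ g x then g x ^ 3 * g y ^ 3 / ‖x - y‖ else 0)
  have hΨm : Measurable (Function.uncurry Ψ) := by
    refine ENNReal.measurable_ofReal.comp (Measurable.ite ?_ ?_ measurable_const)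
    · exact measurableSet_le (by fun_prop) (by fun_prop)
    · fun_prop
  have hΨ : ∫⁻ x, ∫⁻ y, Ψ x y ≤
      ENNReal.ofReal ((1 + ∫ z : Plane, kernelProfile ‖z‖) * B ^ 3) := by
    calc
      _ ≤ ∫⁻ x, ENNReal.ofReal ((1 + ∫ z : Plane, kernelProfile ‖z‖) * B * g x ^ 4) :=
        lintegral_mono fun x ↦ lintegral_sublevel_le hg hint hB hB2 x
      _ = ENNReal.ofReal (∫ x, (1 + ∫ z : Plane, kernelProfile ‖z‖) * B * g x ^ 4) :=
        (ofReal_integral_eq_lintegral_ofReal (hint.const_mul _)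
          (.of_forall fun x ↦ by dsimp only [Pi.zero_apply]; positivity)).symm
      _ = _ := by
        rw [integral_const_mul, ← hB2]
        congr 1
        ring
  calc
    _ ≤ ∫⁻ x, ∫⁻ y, (Ψ x y + Ψ y x) := by
      refine lintegral_mono fun x ↦ lintegral_mono fun y ↦ ?_
      rcases le_total (g y) (g x) with h | h
      · refine le_add_of_le_of_nonneg ?_ zero_le
        simp [Ψ, h]
      · refine le_add_of_nonneg_of_le zero_le ?_
        simp [Ψ, h, norm_sub_rev, mul_comm]
    _ = (∫⁻ x, ∫⁻ y, Ψ x y) + ∫⁻ x, ∫⁻ y, Ψ y x := by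
      rw [← lintegral_add_left (Measurable.lintegral_prod_right hΨm)]
      refine lintegral_congr fun x ↦ lintegral_add_left ?_ _
      exact hΨm.comp measurable_prodMk_left
    _ = (∫⁻ x, ∫⁻ y, Ψ x y) + ∫⁻ x, ∫⁻ y, Ψ x y := by
      rw [lintegral_lintegral_swap (f := fun x y ↦ Ψ y x)
        (hΨm.comp measurable_swap).aemeasurable]
    _ ≤ _ := by
      refine (add_le_add hΨ hΨ).trans_eq ?_
      rw [← ENNReal.ofReal_add (by positivity) (by positivity)]
      congr 1
      ring

lemma integrable_of_lintegral_ofReal_lt_top {w : Plane → ℝ} (hw : Measurable w)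
    (h : ∫⁻ x, ENNReal.ofReal (|w x| ^ ((8 : ℝ) / 3)) < ⊤) :
    Integrable fun x ↦ |w x| ^ ((8 : ℝ) / 3) := by
  refine ⟨(hw.abs.pow_const _).aestronglyMeasurable, ?_⟩
  rwa [hasFiniteIntegral_iff_ofReal (.of_forall fun x ↦ by dsimp only [Pi.zero_apply]; positivity)]

lemma sq_add_sq_rpow_le (a b : ℝ) :
    ((a ^ 2 + b ^ 2) ^ ((1 : ℝ) / 3)) ^ 4 ≤
      2 * (|a| ^ ((8 : ℝ) / 3) + |b| ^ ((8 : ℝ) / 3)) := by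
  have hab : 0 ≤ a ^ 2 + b ^ 2 := by positivity
  have key (c : ℝ) : |c| ^ ((8 : ℝ) / 3) = (c ^ 2) ^ ((4 : ℝ) / 3) := by
    rw [← sq_abs, ← Real.rpow_natCast, ← Real.rpow_mul (abs_nonneg c)]
    norm_num
  rw [key, key, ← Real.rpow_natCast, ← Real.rpow_mul hab]
  have h : (a ^ 2 + b ^ 2) ^ ((4 : ℝ) / 3) ≤
      2 ^ ((4 : ℝ) / 3 - 1) * ((a ^ 2) ^ ((4 : ℝ) / 3) + (b ^ 2) ^ ((4 : ℝ) / 3)) := by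
    exact_mod_cast NNReal.rpow_add_le_mul_rpow_add_rpow ⟨a ^ 2, sq_nonneg a⟩ ⟨b ^ 2, sq_nonneg b⟩
      (p := 4 / 3) (by norm_num)
  have h2 : (2 : ℝ) ^ ((4 : ℝ) / 3 - 1) ≤ 2 := by
    calc (2 : ℝ) ^ ((4 : ℝ) / 3 - 1) ≤ 2 ^ (1 : ℝ) :=
          Real.rpow_le_rpow_of_exponent_le one_le_two (by norm_num)
      _ = 2 := Real.rpow_one 2
  norm_num at h h2 ⊢
  exact h.trans (by gcongr)

lemma sqrt_pow_three_le {I U V : ℝ} (hU : 0 ≤ U) (hV : 0 ≤ V) (h : I ≤ 2 * (U + V)) :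
    √I ^ 3 ≤ 3 * ((U ^ ((3 : ℝ) / 8)) ^ 2 + (V ^ ((3 : ℝ) / 8)) ^ 2) ^ 2 := by
  have key (c : ℝ) (hc : 0 ≤ c) : (c ^ ((3 : ℝ) / 8)) ^ 2 = c ^ ((3 : ℝ) / 4) := by
    rw [← Real.rpow_natCast, ← Real.rpow_mul hc]
    norm_num
  have key2 : √(U + V) ^ 3 = ((U + V) ^ ((3 : ℝ) / 4)) ^ 2 := by
    rw [Real.sqrt_eq_rpow, ← Real.rpow_natCast, ← Real.rpow_natCast,
      ← Real.rpow_mul (by positivity), ← Real.rpow_mul (by positivity)]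
    norm_num
  have h2 : √2 ^ 3 ≤ (3 : ℝ) := by
    nlinarith [Real.sq_sqrt (zero_le_two (α := ℝ)), Real.sqrt_nonneg 2]
  rw [key U hU, key V hV]
  calc √I ^ 3 ≤ √(2 * (U + V)) ^ 3 := by gcongr
    _ = √2 ^ 3 * ((U + V) ^ ((3 : ℝ) / 4)) ^ 2 := by
      rw [Real.sqrt_mul zero_le_two, mul_pow, key2]
    _ ≤ _ := by
      gcongr
      exact Real.rpow_add_le_add_rpow hU hV (by norm_num) (by norm_num)

/-- HLS-type bound: `∬ log(1+1/|x−y|) (u(x)²+v(x)²)(u(y)²+v(y)²) ≲ (‖u‖_{8/3}² + ‖v‖_{8/3}²)²`.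
Note that in Lean `1/‖x-x‖ = 0` so `log (1 + 1/‖x-y‖)` vanishes on the diagonal. -/
theorem stmt9 :
    ∃ C : ℝ, 0 < C ∧ ∀ u v : Plane → ℝ, Measurable u → Measurable v →
      (∫⁻ x, ENNReal.ofReal (|u x| ^ ((8 : ℝ) / 3)) < ⊤) →
      (∫⁻ x, ENNReal.ofReal (|v x| ^ ((8 : ℝ) / 3)) < ⊤) →
      (∫⁻ x, ∫⁻ y, ENNReal.ofReal (Real.log (1 + 1 / ‖x - y‖) *
          ((u x) ^ 2 + (v x) ^ 2) * ((u y) ^ 2 + (v y) ^ 2))) ≤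
        ENNReal.ofReal (C *
          (((∫ x, |u x| ^ ((8 : ℝ) / 3)) ^ ((3 : ℝ) / 8)) ^ 2 +
           ((∫ x, |v x| ^ ((8 : ℝ) / 3)) ^ ((3 : ℝ) / 8)) ^ 2) ^ 2) := by
  have hK : 0 ≤ ∫ z : Plane, kernelProfile ‖z‖ :=
    integral_nonneg fun z ↦ kernelProfile_nonneg (norm_nonneg _)
  refine ⟨2 * (1 + ∫ z : Plane, kernelProfile ‖z‖) * 3, by positivity, fun u v hu hv hu' hv' ↦ ?_⟩
  have hui := integrable_of_lintegral_ofReal_lt_top hu hu'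
  have hvi := integrable_of_lintegral_ofReal_lt_top hv hv'
  let g (x : Plane) : ℝ := (u x ^ 2 + v x ^ 2) ^ ((1 : ℝ) / 3)
  have hg (x : Plane) : 0 ≤ g x := by positivity
  have hgm : Measurable g := by fun_prop
  have hg3 (x : Plane) : g x ^ 3 = u x ^ 2 + v x ^ 2 := by
    dsimp only [g]
    rw [← Real.rpow_natCast, ← Real.rpow_mul (by positivity)]
    norm_num
  have hdom : Integrable fun x ↦ 2 * (|u x| ^ ((8 : ℝ) / 3) + |v x| ^ ((8 : ℝ) / 3)) :=
    (hui.add hvi).const_mul 2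
  have hint : Integrable fun x ↦ g x ^ 4 := by
    refine hdom.mono' (by fun_prop) (.of_forall fun x ↦ ?_)
    rw [Real.norm_of_nonneg (pow_nonneg (hg x) 4)]
    exact sq_add_sq_rpow_le _ _
  have hle : ∫ x, g x ^ 4 ≤
      2 * ((∫ x, |u x| ^ ((8 : ℝ) / 3)) + ∫ x, |v x| ^ ((8 : ℝ) / 3)) := by
    rw [← integral_add hui hvi, ← integral_const_mul]
    exact integral_mono hint hdom fun x ↦ sq_add_sq_rpow_le _ _
  calc
    _ ≤ ∫⁻ x, ∫⁻ y, ENNReal.ofReal (g x ^ 3 * g y ^ 3 / ‖x - y‖) := by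
      refine lintegral_mono fun x ↦ lintegral_mono fun y ↦ ENNReal.ofReal_le_ofReal ?_
      have hlog : Real.log (1 + 1 / ‖x - y‖) ≤ 1 / ‖x - y‖ :=
        (Real.log_le_sub_one_of_pos (by positivity)).trans_eq (by ring)
      rw [hg3, hg3, mul_assoc]
      exact (mul_le_mul_of_nonneg_right hlog (by positivity)).trans_eq (by ring)
    _ ≤ _ := hardyLittlewoodSobolev_plane hgm hg hint
    _ ≤ _ := by
      rw [mul_assoc _ (3 : ℝ)]
      refine ENNReal.ofReal_le_ofReal (mul_le_mul_of_nonneg_left ?_ (by positivity))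
      exact sqrt_pow_three_le (integral_nonneg fun x ↦ by positivity)
        (integral_nonneg fun x ↦ by positivity) hle
end
end
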